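/- arXiv:1202.6423 — 3 statements merged into one kernel-verified Lean document; each statement's English description precedes it below -/
import Mathlib

section
/- Let σ_w > 0, ε > 0, and n ≥ 1, and set P = 2√2·ε·σ_w²/√n. If P < σ_w², then for every measurable set A ⊆ ℝⁿ (Willie's rejection region), the false-alarm and missed-detection probabilities satisfy α + β ≥ 1 − ε, where α = P₀(A), β = P₁(Aᶜ), P₀ = N(0,σ_w²)^⊗n is the distribution of n i.i.d. noise observations and P₁ = N(0,σ_w²+P)^⊗n is the distribution of n i.i.d. observations of a Gaussian signal of power P corrupted by the noise. -/
open MeasureTheory ProbabilityTheory Real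

theorem pinsker_aux {Ω : Type*} [MeasurableSpace Ω] (μ ν : Measure Ω) [IsProbabilityMeasure μ]
    [IsProbabilityMeasure ν] (h : Ω → ℝ) (hm : Measurable h) (hi : Integrable h μ)
    (hν : ν = μ.withDensity (fun x => ENNReal.ofReal (Real.exp (h x))))
    (A : Set Ω) (hA : MeasurableSet A) :
    2 * (μ.real A - ν.real A) ^ 2 ≤ - ∫ x, h x ∂μ := by
  set d := μ.real A - ν.real A with hd
  set X : Ω → ℝ := A.indicator (fun _ => (1:ℝ)) with hX
  have hXm : Measurable X := measurable_const.indicator hA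
  have hXν : ∫ x, X x ∂ν = ν.real A := by simp [hX, integral_indicator hA]
  have hXμ : ∫ x, X x ∂μ = μ.real A := by simp [hX, integral_indicator hA]
  have hXi : Integrable X μ := (integrable_const (1:ℝ)).indicator hA
  have hb : ∀ᵐ ω ∂ν, X ω ∈ Set.Icc (0:ℝ) 1 := by
    refine Filter.Eventually.of_forall fun ω => ?_
    by_cases hω : ω ∈ A <;> simp [hX, hω]
  have hs := hasSubgaussianMGF_of_mem_Icc hXm.aemeasurable hb
  have h1 := hs.mgf_le (4 * d)
  have h2 := hs.integrable_exp_mul (4 * d)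
  rw [hXν] at h1 h2
  unfold mgf at h1
  have hdm : Measurable (fun x => ENNReal.ofReal (Real.exp (h x))) := by fun_prop
  rw [hν, integrable_withDensity_iff_integrable_smul' hdm (by simp)] at h2
  have e1 : ∫ x, Real.exp (4 * d * (X x - ν.real A)) ∂ν
      = ∫ x, Real.exp (4 * d * (X x - ν.real A) + h x) ∂μ := by
    conv_lhs => rw [hν]
    rw [integral_withDensity_eq_integral_toReal_smul hdm (by simp)]
    refine integral_congr_ae (Filter.Eventually.of_forall fun x => ?_)
    simp only [ENNReal.toReal_ofReal (Real.exp_pos _).le, smul_eq_mul]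
    rw [Real.exp_add, mul_comm, ← hν]
  have hint : Integrable (fun x => Real.exp (4 * d * (X x - ν.real A) + h x)) μ := by
    refine h2.congr (Filter.Eventually.of_forall fun x => ?_)
    simp only [ENNReal.toReal_ofReal (Real.exp_pos _).le, smul_eq_mul]
    rw [Real.exp_add, mul_comm, ← hν]
  have hgi : Integrable (fun x => 4 * d * (X x - ν.real A)) μ :=
    (hXi.sub (integrable_const _)).const_mul _
  have J := convexOn_exp.map_integral_le (μ := μ) continuous_exp.continuousOn isClosed_univ
    (f := fun x => 4 * d * (X x - ν.real A) + h x) (by simp) (hgi.add hi) hint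
  rw [integral_add hgi hi, integral_const_mul, integral_sub hXi (integrable_const _), hXμ] at J
  have J2 := (J.trans_eq e1.symm).trans h1
  rw [Real.exp_le_exp] at J2
  simp at J2
  rw [← hd] at J2
  nlinarith

theorem pi_wd {n : ℕ} (μ ν : Measure ℝ) [IsProbabilityMeasure μ]
    [IsProbabilityMeasure ν] (h : ℝ → ℝ) (hm : Measurable h)
    (hν : ν = μ.withDensity (fun x => ENNReal.ofReal (Real.exp (h x)))) :
    Measure.pi (fun _ : Fin n => ν) = (Measure.pi (fun _ : Fin n => μ)).withDensity
      (fun x => ENNReal.ofReal (Real.exp (∑ i, h (x i)))) := by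
  refine Measure.pi_eq fun s hs => ?_
  rw [withDensity_apply _ (MeasurableSet.univ_pi hs), ← lintegral_indicator (MeasurableSet.univ_pi hs)]
  have hf : ∀ i, Measurable ((s i).indicator (fun y => ENNReal.ofReal (Real.exp (h y)))) :=
    fun i => Measurable.indicator (by fun_prop) (hs i)
  have e : (Set.univ.pi s).indicator (fun x : Fin n → ℝ => ENNReal.ofReal (Real.exp (∑ i, h (x i))))
      = fun x => ∏ i, (s i).indicator (fun y => ENNReal.ofReal (Real.exp (h y))) (x i) := by
    funext x
    by_cases hx : x ∈ Set.univ.pi s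
    · rw [Set.indicator_of_mem hx, Real.exp_sum, ENNReal.ofReal_prod_of_nonneg
        (fun _ _ => (Real.exp_pos _).le)]
      exact Finset.prod_congr rfl fun i _ => (Set.indicator_of_mem (hx i trivial)
        (fun y => ENNReal.ofReal (Real.exp (h y)))).symm
    · rw [Set.indicator_of_notMem hx]
      simp only [Set.mem_pi, Set.mem_univ, true_implies, not_forall] at hx
      obtain ⟨i, hi⟩ := hx
      exact (Finset.prod_eq_zero (Finset.mem_univ i) (Set.indicator_of_notMem hi _)).symm
  rw [e]
  have ind : iIndepFun (fun (i : Fin n) (x : Fin n → ℝ) =>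
      (s i).indicator (fun y => ENNReal.ofReal (Real.exp (h y))) (x i))
      (Measure.pi (fun _ : Fin n => μ)) :=
    iIndepFun_pi (fun i => (hf i).aemeasurable)
  rw [lintegral_prod_eq_prod_lintegral_of_indepFun Finset.univ _ ind
    (fun i => (hf i).comp (measurable_pi_apply i))]
  refine Finset.prod_congr rfl fun i _ => ?_
  rw [(measurePreserving_eval (fun _ : Fin n => μ) i).lintegral_comp (hf i),
    lintegral_indicator (hs i), ← withDensity_apply _ (hs i), ← hν]

theorem gauss_wd (v w : NNReal) (hv : 0 < v) (hw : 0 < w) :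
    gaussianReal 0 w = (gaussianReal 0 v).withDensity (fun x => ENNReal.ofReal (Real.exp
      (-(1/2) * Real.log (w / v) + x ^ 2 * ((1 / v - 1 / w) / 2)))) := by
  rw [gaussianReal_of_var_ne_zero _ hv.ne', gaussianReal_of_var_ne_zero _ hw.ne',
    ← withDensity_mul _ (measurable_gaussianPDF _ _) (by fun_prop)]
  congr 1
  funext x
  have hv' : (0:ℝ) < v := hv
  have hw' : (0:ℝ) < w := hw
  simp only [Pi.mul_apply, gaussianPDF]
  rw [← ENNReal.ofReal_mul (gaussianPDFReal_nonneg _ _ _)]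
  congr 1
  unfold gaussianPDFReal
  have e : Real.exp (-(1/2) * Real.log (w / v)) = √v / √w := by
    rw [← Real.sqrt_div hv'.le, Real.sqrt_eq_rpow, Real.rpow_def_of_pos (by positivity)]
    congr 1
    rw [Real.log_div hw'.ne' hv'.ne', Real.log_div hv'.ne' hw'.ne']
    ring
  rw [Real.exp_add, e]
  have e2 : Real.exp (-(x - 0) ^ 2 / (2 * w)) =
      Real.exp (-(x - 0) ^ 2 / (2 * v)) * Real.exp (x ^ 2 * ((1 / v - 1 / w) / 2)) := by
    rw [← Real.exp_add]
    congr 1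
    field_simp
    ring
  rw [e2, Real.sqrt_mul (by positivity) (v:ℝ), Real.sqrt_mul (by positivity) (w:ℝ)]
  have : √(v:ℝ) ≠ 0 := by positivity
  have : √(w:ℝ) ≠ 0 := by positivity
  field_simp

theorem log_aux (s : ℝ) (hs : 0 ≤ s) : Real.log (1 + s) - s / (1 + s) ≤ s ^ 2 / 2 := by
  have hm : MonotoneOn (fun s : ℝ => s ^ 2 / 2 - (Real.log (1 + s) - (1 - (1 + s)⁻¹))) (Set.Ici 0) := by
    have hd : ∀ x : ℝ, 0 ≤ x → HasDerivAt
        (fun s : ℝ => s ^ 2 / 2 - (Real.log (1 + s) - (1 - (1 + s)⁻¹)))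
        (x - (1 / (1 + x) - 1 / (1 + x) ^ 2)) x := by
      intro x hx
      have hne : (1 + x) ≠ 0 := by positivity
      have h0 : HasDerivAt (fun s : ℝ => 1 + s) 1 x := (hasDerivAt_id x).const_add 1
      have h1 := h0.log hne
      have h2 := (h0.inv hne).const_sub 1
      have h3 := ((hasDerivAt_id x).pow 2).div_const 2
      refine (h3.sub (h1.sub h2)).congr_deriv ?_
      simp
      field_simp
      ring
    refine monotoneOn_of_deriv_nonneg (convex_Ici 0)
      (fun x hx => (hd x hx).continuousAt.continuousWithinAt)
      (fun x hx => (hd x (interior_subset hx)).differentiableAt.differentiableWithinAt) ?_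
    intro x hx
    have hx0 : 0 ≤ x := interior_subset hx
    rw [(hd x hx0).deriv]
    have : x - (1 / (1 + x) - 1 / (1 + x) ^ 2) = x * ((1 + x)^2 - 1) / (1 + x) ^ 2 := by
      field_simp
      ring
    rw [this]
    have : 0 ≤ (1 + x)^2 - 1 := by nlinarith
    positivity
  have := hm (Set.mem_Ici.2 le_rfl) (Set.mem_Ici.2 hs) hs
  have e : s / (1 + s) = 1 - (1 + s)⁻¹ := by field_simp; ring
  rw [e]
  simp at this
  linarith

/-- Let `σ_w > 0`, `ε > 0`, `n ≥ 1`, and set `P = 2√2·ε·σ_w²/√n`.  If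
`P < σ_w²`, then for every measurable rejection region `A ⊆ ℝⁿ`, the
false-alarm probability `α = P₀(A)` and missed-detection probability
`β = P₁(Aᶜ)` satisfy `α + β ≥ 1 − ε`, where `P₀ = N(0,σ_w²)^⊗n` and
`P₁ = N(0,σ_w²+P)^⊗n`. -/
theorem stmt_5 (σw ε : ℝ) (hσ : 0 < σw) (hε : 0 < ε) (n : ℕ) (hn : 1 ≤ n)
    (P : ℝ) (hPdef : P = 2 * Real.sqrt 2 * ε * σw ^ 2 / Real.sqrt n)
    (hP : P < σw ^ 2)
    (A : Set (Fin n → ℝ)) (hA : MeasurableSet A) :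
    1 - ε ≤
      ((Measure.pi fun _ : Fin n => gaussianReal 0 (σw ^ 2).toNNReal) A).toReal +
      ((Measure.pi fun _ : Fin n => gaussianReal 0 (σw ^ 2 + P).toNNReal) Aᶜ).toReal := by
  have hn' : (0:ℝ) < n := by exact_mod_cast hn
  have hσ2 : 0 < σw ^ 2 := by positivity
  have hP0 : 0 < P := by rw [hPdef]; positivity
  set v : NNReal := (σw ^ 2).toNNReal with hv
  set w : NNReal := (σw ^ 2 + P).toNNReal with hw
  have hvr : (v : ℝ) = σw ^ 2 := Real.coe_toNNReal _ hσ2.le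
  have hwr : (w : ℝ) = σw ^ 2 + P := Real.coe_toNNReal _ (by positivity)
  have hv0 : 0 < v := Real.toNNReal_pos.2 hσ2
  have hw0 : 0 < w := Real.toNNReal_pos.2 (by positivity)
  let h : ℝ → ℝ := fun x => -(1/2) * Real.log (w / v) + x ^ 2 * ((1 / v - 1 / w) / 2)
  have hm : Measurable h := by fun_prop
  have hsq : Integrable (fun x : ℝ => x ^ 2) (gaussianReal 0 v) :=
    (memLp_id_gaussianReal (μ := 0) (v := v) 2).integrable_sq
  have hsqi : ∫ x, x ^ 2 ∂(gaussianReal 0 v) = v := by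
    have := variance_id_gaussianReal (μ := 0) (v := v)
    rw [variance_of_integral_eq_zero (by fun_prop) (by simp)] at this
    simpa using this
  have hi : Integrable h (gaussianReal 0 v) := (integrable_const _).add (hsq.mul_const _)
  have hhi : ∫ x, h x ∂(gaussianReal 0 v)
      = -(1/2) * Real.log (w / v) + v * ((1 / v - 1 / w) / 2) := by
    simp only [h]
    rw [integral_add (integrable_const _) (hsq.mul_const _), integral_mul_const ((1 / (v:ℝ) - 1 / w) / 2), hsqi]
    simp
  have hpi := pi_wd (n := n) _ _ h hm (gauss_wd v w hv0 hw0)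
  have hii : ∀ i : Fin n, Integrable (fun x : Fin n → ℝ => h (x i))
      (Measure.pi fun _ : Fin n => gaussianReal 0 v) := fun i =>
    integrable_comp_eval (μ := fun _ : Fin n => gaussianReal 0 v) hi
  have key := pinsker_aux _ _ (fun x : Fin n → ℝ => ∑ i, h (x i)) (by fun_prop)
    (integrable_finsetSum _ fun i _ => hii i) hpi A hA
  rw [integral_finsetSum _ fun i _ => hii i] at key
  have hev : ∀ i : Fin n, ∫ x : Fin n → ℝ, h (x i) ∂(Measure.pi fun _ : Fin n => gaussianReal 0 v)
      = ∫ x, h x ∂(gaussianReal 0 v) := fun i =>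
    integral_comp_eval (μ := fun _ : Fin n => gaussianReal 0 v) hi.aestronglyMeasurable
  simp only [hev, hhi, Finset.sum_const, Finset.card_univ, Fintype.card_fin, nsmul_eq_mul] at key
  have hs := log_aux (P / σw ^ 2) (by positivity)
  have e1 : (w : ℝ) / v = 1 + P / σw ^ 2 := by rw [hvr, hwr]; field_simp
  have e2 : (v : ℝ) * ((1 / v - 1 / w) / 2) = (P / σw ^ 2 / (1 + P / σw ^ 2)) / 2 := by
    rw [hvr, hwr]; field_simp; ring
  have e3 : (n:ℝ) * (P / σw ^ 2) ^ 2 = 8 * ε ^ 2 := by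
    rw [hPdef]
    have a1 : √(n:ℝ) ^ 2 = n := Real.sq_sqrt hn'.le
    have a2 : √(2:ℝ) ^ 2 = 2 := Real.sq_sqrt (by norm_num)
    have a3 : √(n:ℝ) ≠ 0 := by positivity
    field_simp
    rw [a1, a2]
    ring
  rw [e1, e2] at key
  have hs' := mul_le_mul_of_nonneg_left hs hn'.le
  have hd := abs_le_of_sq_le_sq' (a := (Measure.pi fun _ : Fin n => gaussianReal 0 v).real A -
    (Measure.pi fun _ : Fin n => gaussianReal 0 w).real A) (b := ε) (by nlinarith) hε.le
  have hc := probReal_compl_eq_one_sub (μ := Measure.pi fun _ : Fin n => gaussianReal 0 w) hA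
  simp only [Measure.real] at hc hd
  rw [hc]
  linarith [hd.1]
end

section
/- Let σ > 0, n ≥ 1, and 0 ≤ a < σ. Let Q_a = (1/2)·N(−a,σ²) + (1/2)·N(a,σ²). Then the total variation distance between product measures satisfies TV( N(0,σ²)^⊗n , Q_a^⊗n ) ≤ (a²/(2σ²))·√(n/2). -/
open MeasureTheory ProbabilityTheory Real
open scoped ENNReal NNReal

/-- The total variation distance between two measures: the supremum over
measurable sets `A` of `|P(A) − Q(A)|`. -/
noncomputable def tvDist {α : Type*} [MeasurableSpace α] (P Q : Measure α) : ℝ :=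
  ⨆ A : {s : Set α // MeasurableSet s}, |(P A.1).toReal - (Q A.1).toReal|

lemma cosh_ge_aux (x : ℝ) : 1 + x ^ 2 / 2 + x ^ 4 / 24 ≤ Real.cosh x := by
  have h := sum_le_hasSum (Finset.range 3) (fun i _ => by
    have : 0 ≤ x ^ (2 * i) := by rw [pow_mul]; positivity
    positivity) (Real.hasSum_cosh x)
  simp [Finset.sum_range_succ, Nat.factorial] at h
  linarith

lemma sqrt_cosh_ge_aux (x : ℝ) : 1 + x ^ 2 / 4 - x ^ 4 / 96 ≤ Real.sqrt (Real.cosh x) := by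
  rcases le_or_gt (1 + x ^ 2 / 4 - x ^ 4 / 96) 0 with h | h
  · exact h.trans (Real.sqrt_nonneg _)
  · apply Real.le_sqrt_of_sq_le
    refine le_trans ?_ (cosh_ge_aux x)
    have e : x ^ 4 = (x ^ 2) ^ 2 := by ring
    rw [e] at h ⊢
    have hy : 0 ≤ x ^ 2 := sq_nonneg x
    generalize x ^ 2 = y at *
    have h48 : y ≤ 48 := by nlinarith
    have : 0 ≤ y ^ 3 * (48 - y) := by
      have : 0 ≤ 48 - y := by linarith
      positivity
    nlinarith

lemma num_aux (t : ℝ) (h0 : 0 ≤ t) (h1 : t < 1) :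
    1 - t ^ 2 / 8 ≤ (Real.exp (-t / 4) * (1 + t / 4 - t ^ 2 / 32)) ^ 2 := by
  have he : 1 - t / 2 + t ^ 2 / 8 - t ^ 3 / 48 - 5 * t ^ 4 / 1536 ≤ Real.exp (-t / 2) := by
    have h := Real.exp_bound (x := -t / 2) (by rw [abs_le]; constructor <;> linarith) (n := 4)
      (by norm_num)
    rw [abs_le] at h
    have h := h.1
    have e : |-t / 2| = t / 2 := by rw [abs_of_nonpos (by linarith)]; ring
    rw [e] at h
    simp [Finset.sum_range_succ, Nat.factorial] at h
    linarith
  have : (Real.exp (-t / 4)) ^ 2 = Real.exp (-t / 2) := by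
    rw [← Real.exp_nat_mul]; congr 1; push_cast; ring
  rw [mul_pow, this]
  refine le_trans ?_ (mul_le_mul_of_nonneg_right he (sq_nonneg _))
  have h3 : 0 ≤ t ^ 3 := by positivity
  have p1 : t ^ 4 ≤ t ^ 3 := pow_le_pow_of_le_one h0 h1.le (by norm_num)
  have p2 : t ^ 5 ≤ t ^ 3 := pow_le_pow_of_le_one h0 h1.le (by norm_num)
  have p3 : t ^ 6 ≤ t ^ 3 := pow_le_pow_of_le_one h0 h1.le (by norm_num)
  have p4 : t ^ 7 ≤ t ^ 3 := pow_le_pow_of_le_one h0 h1.le (by norm_num)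
  have p5 : t ^ 8 ≤ t ^ 3 := pow_le_pow_of_le_one h0 h1.le (by norm_num)
  have q1 : 0 ≤ t ^ 4 := by positivity
  have q2 : 0 ≤ t ^ 5 := by positivity
  have q3 : 0 ≤ t ^ 6 := by positivity
  have q4 : 0 ≤ t ^ 7 := by positivity
  have q5 : 0 ≤ t ^ 8 := by positivity
  ring_nf
  linarith

lemma tv_aux {α : Type*} [MeasurableSpace α] (P Q : Measure α) [IsProbabilityMeasure P]
    (g : α → ℝ) (hg0 : ∀ x, 0 ≤ g x) (hgi : Integrable g P)
    (hg2 : Integrable (fun x => g x ^ 2) P) (h1 : ∫ x, g x ^ 2 ∂P = 1)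
    (hQ : Q = P.withDensity (fun x => ENNReal.ofReal (g x ^ 2))) :
    tvDist P Q ≤ Real.sqrt (1 - (∫ x, g x ∂P) ^ 2) := by
  set b := ∫ x, g x ∂P with hb
  have hb0 : 0 ≤ b := integral_nonneg hg0
  have hi1 : Integrable (fun x => 1 - g x ^ 2) P := (integrable_const _).sub hg2
  have hz : ∫ x, (1 - g x ^ 2) ∂P = 0 := by
    rw [integral_sub (integrable_const _) hg2, h1]; simp
  set I := ∫ x, |1 - g x ^ 2| ∂P with hI
  have hI2 : I ^ 2 ≤ 4 * (1 - b ^ 2) := by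
    set c := I / (2 + 2 * b) with hc
    have key : 0 ≤ ∫ x, ((1 + c ^ 2) + (-2 + 2 * c ^ 2) * g x + (1 + c ^ 2) * g x ^ 2
        - 2 * c * |1 - g x ^ 2|) ∂P := by
      refine integral_nonneg fun x => ?_
      have : |1 - g x ^ 2| = |1 - g x| * (1 + g x) := by
        rw [show 1 - g x ^ 2 = (1 - g x) * (1 + g x) by ring, abs_mul,
          abs_of_nonneg (a := 1 + g x) (by linarith [hg0 x])]
      show 0 ≤ _
      rw [this]
      have h := sq_nonneg (|1 - g x| - c * (1 + g x))
      have h' := sq_abs (1 - g x)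
      nlinarith
    rw [integral_sub, integral_add, integral_add, integral_const_mul, integral_const_mul,
      integral_const_mul, h1, ← hb, ← hI] at key
    · simp only [integral_const, probReal_univ, one_smul] at key
      have hB : 0 < 2 + 2 * b := by linarith
      have hcI : c * (2 + 2 * b) = I := by rw [hc]; field_simp
      rw [← hcI] at key ⊢
      have : 0 ≤ (2 - 2 * b) - c ^ 2 * (2 + 2 * b) := by nlinarith
      nlinarith [mul_nonneg this hB.le]
    · exact integrable_const _
    · exact hgi.const_mul _
    · exact (integrable_const _).add (hgi.const_mul _)
    · exact hg2.const_mul _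
    · exact ((integrable_const _).add (hgi.const_mul _)).add (hg2.const_mul _)
    · exact hi1.abs.const_mul _
  unfold tvDist
  haveI : Nonempty {s : Set α // MeasurableSet s} := ⟨⟨∅, MeasurableSet.empty⟩⟩
  refine ciSup_le fun A => ?_
  obtain ⟨A, hA⟩ := A
  apply Real.le_sqrt_of_sq_le
  have hQA : (Q A).toReal = ∫ x in A, g x ^ 2 ∂P := by
    rw [hQ, withDensity_apply _ hA, ← ofReal_integral_eq_lintegral_ofReal hg2.integrableOn
      (ae_of_all _ fun x => sq_nonneg _), ENNReal.toReal_ofReal]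
    exact integral_nonneg fun x => sq_nonneg _
  have hPA : (P A).toReal - (Q A).toReal = ∫ x in A, (1 - g x ^ 2) ∂P := by
    rw [hQA, integral_sub (integrable_const _) hg2.integrableOn]
    simp [Measure.real]
  have hc := integral_add_compl hA hi1
  rw [hz] at hc
  have hI' := integral_add_compl hA hi1.abs
  have a1 := abs_integral_le_integral_abs (μ := P.restrict A) (f := fun x => 1 - g x ^ 2)
  have a2 := abs_integral_le_integral_abs (μ := P.restrict Aᶜ) (f := fun x => 1 - g x ^ 2)
  have a3 : |∫ x in Aᶜ, (1 - g x ^ 2) ∂P| = |∫ x in A, (1 - g x ^ 2) ∂P| := by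
    rw [← abs_neg]; congr 1; linarith
  show |(P A).toReal - (Q A).toReal| ^ 2 ≤ _
  rw [hPA]
  rw [a3] at a2
  have : 2 * |∫ x in A, (1 - g x ^ 2) ∂P| ≤ I := by rw [hI, ← hI']; linarith
  have h0 := abs_nonneg (∫ x in A, (1 - g x ^ 2) ∂P)
  nlinarith

lemma pi_withDensity_aux {n : ℕ} (P : Measure ℝ) [IsProbabilityMeasure P] (L : ℝ → ℝ)
    (hL0 : ∀ x, 0 ≤ L x) (hLi : Integrable L P)
    [IsProbabilityMeasure (P.withDensity fun x => ENNReal.ofReal (L x))] :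
    (Measure.pi fun _ : Fin n => P.withDensity fun x => ENNReal.ofReal (L x)) =
      (Measure.pi fun _ : Fin n => P).withDensity
        (fun x => ENNReal.ofReal (∏ i, L (x i))) := by
  refine Measure.pi_eq fun s hs => ?_
  rw [withDensity_apply _ (MeasurableSet.univ_pi hs), Measure.restrict_pi_pi,
    ← ofReal_integral_eq_lintegral_ofReal, integral_fintype_prod_eq_prod,
    ENNReal.ofReal_prod_of_nonneg]
  · refine Finset.prod_congr rfl fun i _ => ?_
    rw [withDensity_apply _ (hs i), ofReal_integral_eq_lintegral_ofReal hLi.integrableOn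
      (ae_of_all _ hL0)]
  · intro i _
    exact integral_nonneg hL0
  · exact Integrable.fintype_prod (fun i => hLi.integrableOn)
  · exact ae_of_all _ fun x => Finset.prod_nonneg fun i _ => hL0 _

lemma mom_aux (v : ℝ≥0) : ∫ x, x ^ 2 ∂(gaussianReal 0 v) = v ∧
    ∫ x, x ^ 4 ∂(gaussianReal 0 v) = 3 * (v : ℝ) ^ 2 := by
  have hd : ∀ (p p' : ℝ → ℝ), (∀ t, HasDerivAt p (p' t) t) →
      deriv (fun t => p t * rexp (v * t ^ 2 / 2)) =
        fun t => (p' t + p t * (v * t)) * rexp (v * t ^ 2 / 2) := by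
    intro p p' hp
    funext t
    have h2 : HasDerivAt (fun t : ℝ => (v : ℝ) * t ^ 2 / 2) (v * t) t := by
      have := (((hasDerivAt_id t).pow 2).const_mul (v : ℝ)).div_const 2
      convert! this using 1
      simp; ring
    refine ((hp t).mul h2.exp).deriv.trans ?_
    ring
  have hm : mgf (fun x => x) (gaussianReal 0 v) = fun t => 1 * rexp (v * t ^ 2 / 2) := by
    rw [mgf_fun_id_gaussianReal]; simp
  have i0 : (0 : ℝ) ∈ interior (integrableExpSet (fun x => x) (gaussianReal 0 v)) := by simp
  have d1 := hd (fun _ => 1) (fun _ => 0) (fun t => hasDerivAt_const t _)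
  have d2 := hd (fun t => 0 + 1 * (v * t)) (fun _ => v) (fun t => by
    simpa using (hasDerivAt_id t).const_mul (v : ℝ))
  have d3 := hd (fun t => v + (0 + 1 * (v * t)) * (v * t)) (fun t => 2 * v ^ 2 * t) (fun t => by
    have := (((hasDerivAt_id t).pow 2).const_mul ((v : ℝ) ^ 2)).const_add (v : ℝ)
    convert! this using 1
    · funext s; simp; ring
    · simp; ring)
  have d4 := hd (fun t => 2 * v ^ 2 * t + (v + (0 + 1 * (v * t)) * (v * t)) * (v * t))
    (fun t => 3 * v ^ 2 + 3 * v ^ 3 * t ^ 2) (fun t => by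
    have := (((hasDerivAt_id t).pow 3).const_mul ((v : ℝ) ^ 3)).add
      ((hasDerivAt_id t).const_mul (3 * (v : ℝ) ^ 2))
    convert! this using 1
    · funext s; simp; ring
    · simp; ring)
  constructor
  · have h := iteratedDeriv_mgf_zero i0 2
    rw [hm, iteratedDeriv_succ, iteratedDeriv_one, d1, d2] at h
    simpa using h.symm
  · have h := iteratedDeriv_mgf_zero i0 4
    rw [hm, iteratedDeriv_succ, iteratedDeriv_succ, iteratedDeriv_succ, iteratedDeriv_one,
      d1, d2, d3, d4] at h
    simpa using h.symm

lemma mix_aux (σ a : ℝ) (hσ : 0 < σ) :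
    (1 / 2 : ℝ≥0∞) • gaussianReal (-a) (σ ^ 2).toNNReal +
            (1 / 2 : ℝ≥0∞) • gaussianReal a (σ ^ 2).toNNReal =
    (gaussianReal 0 (σ ^ 2).toNNReal).withDensity
      (fun x => ENNReal.ofReal (rexp (-(a ^ 2 / σ ^ 2) / 2) * Real.cosh (a / σ ^ 2 * x))) := by
  have hv : (σ ^ 2).toNNReal ≠ 0 := by
    simp; positivity
  have hvr : (((σ ^ 2).toNNReal : ℝ≥0) : ℝ) = σ ^ 2 := Real.coe_toNNReal _ (sq_nonneg _)
  rw [gaussianReal_of_var_ne_zero _ hv, gaussianReal_of_var_ne_zero _ hv,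
    gaussianReal_of_var_ne_zero _ hv, ← withDensity_mul _ (measurable_gaussianPDF _ _)
    (by fun_prop), ← withDensity_smul _ (measurable_gaussianPDF _ _),
    ← withDensity_smul _ (measurable_gaussianPDF _ _), ← withDensity_add_left
    ((measurable_gaussianPDF _ _).const_smul _)]
  congr 1
  funext x
  have h2 : (1 / 2 : ℝ≥0∞) = ENNReal.ofReal (1 / 2) := by
    rw [ENNReal.ofReal_div_of_pos] <;> simp
  simp only [Pi.add_apply, Pi.smul_apply, Pi.mul_apply, gaussianPDF, smul_eq_mul, h2]
  rw [← ENNReal.ofReal_mul (by norm_num), ← ENNReal.ofReal_mul (by norm_num),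
    ← ENNReal.ofReal_add, ← ENNReal.ofReal_mul (gaussianPDFReal_nonneg _ _ _)]
  · congr 1
    simp only [gaussianPDFReal, hvr, Real.cosh_eq]
    have e1 : rexp (-(x - -a) ^ 2 / (2 * σ ^ 2)) =
        rexp (-(x - 0) ^ 2 / (2 * σ ^ 2)) * (rexp (-(a ^ 2 / σ ^ 2) / 2) *
          rexp (-(a / σ ^ 2 * x))) := by
      rw [← Real.exp_add, ← Real.exp_add]; congr 1; field_simp; ring
    have e2 : rexp (-(x - a) ^ 2 / (2 * σ ^ 2)) =
        rexp (-(x - 0) ^ 2 / (2 * σ ^ 2)) * (rexp (-(a ^ 2 / σ ^ 2) / 2) *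
          rexp ((a / σ ^ 2 * x))) := by
      rw [← Real.exp_add, ← Real.exp_add]; congr 1; field_simp; ring
    rw [e1, e2]; ring
  · exact mul_nonneg (by norm_num) (gaussianPDFReal_nonneg _ _ _)
  · exact mul_nonneg (by norm_num) (gaussianPDFReal_nonneg _ _ _)

/-- For `σ > 0`, `n ≥ 1` and `0 ≤ a < σ`, letting
`Q_a = (1/2)·N(−a,σ²) + (1/2)·N(a,σ²)`, the total variation distance between
`n`-fold products satisfies `TV(N(0,σ²)^⊗n, Q_a^⊗n) ≤ (a²/(2σ²))·√(n/2)`. -/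
theorem stmt_8 (σ a : ℝ) (hσ : 0 < σ) (n : ℕ) (hn : 1 ≤ n)
    (ha0 : 0 ≤ a) (ha : a < σ) :
    tvDist (Measure.pi fun _ : Fin n => gaussianReal 0 (σ ^ 2).toNNReal)
        (Measure.pi fun _ : Fin n =>
          (1 / 2 : ℝ≥0∞) • gaussianReal (-a) (σ ^ 2).toNNReal +
            (1 / 2 : ℝ≥0∞) • gaussianReal a (σ ^ 2).toNNReal)
      ≤ (a ^ 2 / (2 * σ ^ 2)) * Real.sqrt (n / 2) := by
  have hvr : (((σ ^ 2).toNNReal : ℝ≥0) : ℝ) = σ ^ 2 := Real.coe_toNNReal _ (sq_nonneg _)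
  obtain ⟨m2, m4⟩ := mom_aux (σ ^ 2).toNNReal
  rw [hvr] at m2 m4
  have hprob : IsProbabilityMeasure ((1 / 2 : ℝ≥0∞) • gaussianReal (-a) (σ ^ 2).toNNReal +
            (1 / 2 : ℝ≥0∞) • gaussianReal a (σ ^ 2).toNNReal) := by
    constructor
    simp [ENNReal.inv_two_add_inv_two]
  have hmix := mix_aux σ a hσ
  rw [hmix] at hprob ⊢
  set P := gaussianReal 0 (σ ^ 2).toNNReal with hP
  set t := a ^ 2 / σ ^ 2 with ht
  have ht0 : 0 ≤ t := by positivity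
  have ht1 : t < 1 := by
    rw [ht, div_lt_one (by positivity)]; nlinarith
  set g : ℝ → ℝ := fun x => rexp (-t / 4) * √(Real.cosh (a / σ ^ 2 * x)) with hg
  have hg0 : ∀ x, 0 ≤ g x := fun x => by positivity
  have hgsq : ∀ x, rexp (-t / 2) * Real.cosh (a / σ ^ 2 * x) = g x ^ 2 := by
    intro x
    rw [hg]
    simp only
    rw [mul_pow, Real.sq_sqrt (Real.cosh_pos _).le, ← Real.exp_nat_mul]
    congr 2; push_cast; ring
  simp only [hgsq] at hprob ⊢
  have hgm : Measurable g := by fun_prop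
  have hLi : Integrable (fun x => g x ^ 2) P := by
    simp only [← hgsq, Real.cosh_eq]
    apply Integrable.const_mul
    apply Integrable.div_const
    refine (integrable_exp_mul_gaussianReal _).add ?_
    simpa only [neg_mul] using integrable_exp_mul_gaussianReal (-(a / σ ^ 2))
  have hL2 : MemLp g 2 P := (memLp_two_iff_integrable_sq hgm.aestronglyMeasurable).2 hLi
  have hgi : Integrable g P := hL2.integrable (by norm_num)
  have hL1 : ∫ x, g x ^ 2 ∂P = 1 := by
    have := hprob.measure_univ
    rw [withDensity_apply _ MeasurableSet.univ, Measure.restrict_univ,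
      ← ofReal_integral_eq_lintegral_ofReal hLi (ae_of_all _ fun x => sq_nonneg _)] at this
    simpa using this
  have hpi := pi_withDensity_aux (n := n) P (fun x => g x ^ 2) (fun x => sq_nonneg _) hLi
  rw [hpi]
  have htv := tv_aux (Measure.pi fun _ : Fin n => P) _ (fun x => ∏ i, g (x i))
    (fun x => Finset.prod_nonneg fun i _ => hg0 _) (Integrable.fintype_prod fun _ => hgi)
    (by simp only [← Finset.prod_pow]; exact Integrable.fintype_prod (f := fun _ x => g x ^ 2) fun _ => hLi)
    (by
      simp only [← Finset.prod_pow]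
      rw [integral_fintype_prod_eq_pow (fun x => g x ^ 2), hL1, one_pow])
    rfl
  simp only [← Finset.prod_pow] at htv
  refine htv.trans ?_
  rw [integral_fintype_prod_eq_pow g, Fintype.card_fin]
  -- lower bound on the affinity
  have hid : ∀ k : ℕ, Integrable (fun x : ℝ => x ^ k) P := fun k => by
    have := (memLp_id_gaussianReal (μ := 0) (v := (σ ^ 2).toNNReal) (k : ℝ≥0))
    have h := MemLp.integrable_norm_pow' (p := k) (by simpa using this)
    exact h.mono' (by fun_prop) (ae_of_all _ fun x => by simp)
  have hbc : rexp (-t / 4) * (1 + t / 4 - t ^ 2 / 32) ≤ ∫ x, g x ∂P := by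
    have h1 : ∫ x, rexp (-t / 4) * (1 + (a / σ ^ 2) ^ 2 / 4 * x ^ 2
        - (a / σ ^ 2) ^ 4 / 96 * x ^ 4) ∂P = rexp (-t / 4) * (1 + t / 4 - t ^ 2 / 32) := by
      rw [integral_const_mul, integral_sub, integral_add, integral_const_mul, integral_const_mul,
        m2, m4]
      · simp only [integral_const, probReal_univ, one_smul, ht]
        field_simp
        ring
      · exact integrable_const _
      · exact (hid 2).const_mul _
      · exact (integrable_const _).add ((hid 2).const_mul _)
      · exact (hid 4).const_mul _
    rw [← h1]
    refine integral_mono ?_ hgi fun x => ?_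
    · exact (((integrable_const _).add ((hid 2).const_mul _)).sub
        ((hid 4).const_mul _)).const_mul _
    · refine mul_le_mul_of_nonneg_left ?_ (Real.exp_pos _).le
      refine le_trans (le_of_eq ?_) (sqrt_cosh_ge_aux _)
      ring
  have hb2 : 1 - t ^ 2 / 8 ≤ (∫ x, g x ∂P) ^ 2 := by
    refine (num_aux t ht0 ht1).trans (pow_le_pow_left₀ ?_ hbc 2)
    have : 0 ≤ 1 + t / 4 - t ^ 2 / 32 := by nlinarith
    positivity
  have hb3 : 1 - n * (t ^ 2 / 8) ≤ ((∫ x, g x ∂P) ^ n) ^ 2 := by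
    have h := one_add_mul_le_pow (a := -(t ^ 2 / 8)) (by nlinarith) n
    rw [← pow_mul, mul_comm n 2, pow_mul]
    refine le_trans ?_ (pow_le_pow_left₀ (by nlinarith) hb2 n)
    rw [← sub_eq_add_neg] at h
    linarith
  have e : a ^ 2 / (2 * σ ^ 2) = t / 2 := by rw [ht]; field_simp
  rw [e]
  apply Real.sqrt_le_iff.2
  refine ⟨by positivity, ?_⟩
  rw [mul_pow, Real.sq_sqrt (by positivity)]
  nlinarith
end

section
/- Let σ > 0 and d > 0. For each n let f⁽ⁿ⁾ ∈ ℝⁿ be a codeword with average power P_n = (1/n)·Σ_{i=1}^n (f⁽ⁿ⁾_i)², and suppose √n·P_n → ∞ as n → ∞. Consider Willie's test with threshold t_n = d/√n, which rejects the null hypothesis when S_n = (1/n)·Σ_{i=1}^n (Y_i)² ≥ σ² + t_n, where Y_i are his n channel observations. Then: (i) under the null hypothesis (Y_i = Z_i with Z_i i.i.d. N(0,σ²)), the false-alarm probability satisfies α_n ≤ 2σ⁴/d² for every n; and (ii) under transmission of f⁽ⁿ⁾ (Y_i = f⁽ⁿ⁾_i + Z_i), the missed-detection probability β_n = P(S_n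 < σ² + t_n) tends to 0 as n → ∞. -/
open MeasureTheory ProbabilityTheory Real Filter

lemma aux_moments (v : NNReal) :
    (∫ x, x ∂gaussianReal 0 v = 0) ∧ (∫ x, x ^ 2 ∂gaussianReal 0 v = v) ∧
    (∫ x, x ^ 3 ∂gaussianReal 0 v = 0) ∧ (∫ x, x ^ 4 ∂gaussianReal 0 v = 3 * (v : ℝ) ^ 2) := by
  have hk : ∀ k : ℕ, ∫ x, x ^ k ∂gaussianReal 0 v
      = iteratedDeriv k (mgf (fun x ↦ x) (gaussianReal 0 v)) 0 := by
    intro k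
    rw [iteratedDeriv_mgf_zero] <;> simp
  have hE : ∀ t : ℝ, HasDerivAt (fun t : ℝ => rexp (v * t ^ 2 / 2))
      (rexp (v * t ^ 2 / 2) * (v * t)) t := by
    intro t
    have h : HasDerivAt (fun t : ℝ => (v : ℝ) * t ^ 2 / 2) (v * t) t := by
      have := ((hasDerivAt_pow 2 t).const_mul (v : ℝ)).div_const 2
      convert! this using 1
      simp; ring
    exact h.exp
  have hm : mgf (fun x ↦ x) (gaussianReal 0 v) = fun t => rexp (v * t ^ 2 / 2) := by
    rw [mgf_fun_id_gaussianReal]; simp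
  have d1 : iteratedDeriv 1 (mgf (fun x ↦ x) (gaussianReal 0 v))
      = fun t => (v * t) * rexp (v * t ^ 2 / 2) := by
    rw [iteratedDeriv_one, hm]
    ext t
    rw [(hE t).deriv]; ring
  have d2 : iteratedDeriv 2 (mgf (fun x ↦ x) (gaussianReal 0 v))
      = fun t => (v + v ^ 2 * t ^ 2) * rexp (v * t ^ 2 / 2) := by
    rw [iteratedDeriv_succ, d1]
    ext t
    have := (((hasDerivAt_id t).const_mul (v : ℝ))).mul (hE t)
    refine (HasDerivAt.congr_deriv this ?_).deriv
    simp; ring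
  have d3 : iteratedDeriv 3 (mgf (fun x ↦ x) (gaussianReal 0 v))
      = fun t => (3 * v ^ 2 * t + v ^ 3 * t ^ 3) * rexp (v * t ^ 2 / 2) := by
    rw [iteratedDeriv_succ, d2]
    ext t
    have := (((hasDerivAt_pow 2 t).const_mul ((v : ℝ) ^ 2)).const_add (v : ℝ)).mul (hE t)
    refine (HasDerivAt.congr_deriv this ?_).deriv
    simp; ring
  have d4 : iteratedDeriv 4 (mgf (fun x ↦ x) (gaussianReal 0 v)) 0 = 3 * v ^ 2 := by
    rw [iteratedDeriv_succ, d3]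
    have := (((hasDerivAt_id (0 : ℝ)).const_mul (3 * (v : ℝ) ^ 2)).add
      ((hasDerivAt_pow 3 (0 : ℝ)).const_mul ((v : ℝ) ^ 3))).mul (hE 0)
    refine (HasDerivAt.congr_deriv this ?_).deriv
    simp
  refine ⟨by simp, ?_, ?_, ?_⟩
  · rw [hk, d2]; simp
  · rw [hk, d3]; simp
  · rw [hk, d4]

lemma aux_int (v : NNReal) (k : ℕ) : Integrable (fun x : ℝ => x ^ k) (gaussianReal 0 v) := by
  have := (memLp_id_gaussianReal (μ := 0) (v := v) (k : NNReal))
  have h2 := MemLp.integrable_norm_pow' (p := k) (by simpa using this)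
  refine h2.mono' (by fun_prop) (ae_of_all _ fun x => ?_)
  simp

lemma aux_poly (v : NNReal) (a : ℝ) :
    (∫ x, (a + x) ^ 2 ∂gaussianReal 0 v = a ^ 2 + v) ∧
    (∫ x, (a + x) ^ 4 ∂gaussianReal 0 v = a ^ 4 + 6 * a ^ 2 * v + 3 * (v : ℝ) ^ 2) ∧
    Integrable (fun x => (a + x) ^ 4) (gaussianReal 0 v) := by
  obtain ⟨m1, m2, m3, m4⟩ := aux_moments v
  have i1 : Integrable (fun x : ℝ => x) (gaussianReal 0 v) := by simpa using aux_int v 1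
  have i2 := aux_int v 2
  have i3 := aux_int v 3
  have i4 := aux_int v 4
  have e2 : (fun x : ℝ => (a + x) ^ 2) = fun x => a ^ 2 + (2 * a * x + x ^ 2) := by
    ext x; ring
  have e4 : (fun x : ℝ => (a + x) ^ 4) =
      fun x => a ^ 4 + (4 * a ^ 3 * x + (6 * a ^ 2 * x ^ 2 + (4 * a * x ^ 3 + x ^ 4))) := by
    ext x; ring
  have j3 := (i3.const_mul (4 * a)).fun_add i4
  have j2 := (i2.const_mul (6 * a ^ 2)).fun_add j3
  have j1 := (i1.const_mul (4 * a ^ 3)).fun_add j2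
  refine ⟨?_, ?_, ?_⟩
  · rw [e2, integral_add (integrable_const _) ((i1.const_mul _).fun_add i2),
      integral_add (i1.const_mul _) i2, integral_const_mul, m1, m2]
    simp
  · rw [e4, integral_add (integrable_const _) j1, integral_add (i1.const_mul _) j2,
      integral_add (i2.const_mul _) j3, integral_add (i3.const_mul _) i4]
    have k1 : ∫ x, 4 * a ^ 3 * x ∂gaussianReal 0 v = 0 := by
      rw [integral_const_mul, m1, mul_zero]
    rw [k1]
    simp only [integral_const_mul, m2, m3, m4]
    simp; ring
  · rw [e4]; exact (integrable_const _).fun_add j1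

lemma aux_memLp (v : NNReal) (a : ℝ) : MemLp (fun x => (a + x) ^ 2) 2 (gaussianReal 0 v) := by
  rw [memLp_two_iff_integrable_sq (by fun_prop)]
  have := (aux_poly v a).2.2
  convert! this using 2
  ring

lemma aux_var (v : NNReal) (a : ℝ) :
    Var[fun x => (a + x) ^ 2; gaussianReal 0 v] = 4 * a ^ 2 * v + 2 * (v : ℝ) ^ 2 := by
  rw [variance_eq_sub (aux_memLp v a), (aux_poly v a).1]
  have : ((fun x : ℝ => (a + x) ^ 2) ^ 2) = fun x => (a + x) ^ 4 := by
    ext x; simp only [Pi.pow_apply]; ring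
  rw [this, (aux_poly v a).2.1]
  ring

lemma aux_cheb (v : NNReal) (n : ℕ) (g : Fin n → ℝ) (c : ℝ) (hc : 0 < c) :
    ((Measure.pi fun _ : Fin n => gaussianReal 0 v)
      {z : Fin n → ℝ | c ≤ |∑ i, (g i + z i) ^ 2 - (∑ i, g i ^ 2 + n * v)|}).toReal
    ≤ (4 * v * ∑ i, g i ^ 2 + 2 * n * (v : ℝ) ^ 2) / c ^ 2 := by
  have hmem : ∀ i : Fin n, MemLp (fun z : Fin n → ℝ => (g i + z i) ^ 2) 2
      (Measure.pi fun _ : Fin n => gaussianReal 0 v) := fun i =>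
    (aux_memLp v (g i)).comp_measurePreserving
      (measurePreserving_eval (fun _ : Fin n => gaussianReal 0 v) i)
  have hsum : MemLp (∑ i, fun z : Fin n → ℝ => (g i + z i) ^ 2) 2
      (Measure.pi fun _ : Fin n => gaussianReal 0 v) := memLp_finsetSum' _ fun i _ => hmem i
  have hvar := variance_sum_pi (μ := fun _ : Fin n => gaussianReal 0 v)
    (X := fun i x => (g i + x) ^ 2) (fun i => aux_memLp v (g i))
  have hmean : ∫ z, (∑ i, fun z : Fin n → ℝ => (g i + z i) ^ 2) z
      ∂(Measure.pi fun _ : Fin n => gaussianReal 0 v) = ∑ i, g i ^ 2 + n * v := by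
    simp only [Finset.sum_apply]
    rw [integral_finsetSum _ fun i _ => (hmem i).integrable (by norm_num)]
    have : ∀ i : Fin n, ∫ z : Fin n → ℝ, (g i + z i) ^ 2
        ∂(Measure.pi fun _ : Fin n => gaussianReal 0 v) = g i ^ 2 + v := by
      intro i
      rw [← (aux_poly v (g i)).1]
      exact integral_comp_eval (μ := fun _ : Fin n => gaussianReal 0 v) (i := i)
        (f := fun x => (g i + x) ^ 2) (by fun_prop)
    simp [this, Finset.sum_add_distrib]
  have h := meas_ge_le_variance_div_sq hsum hc
  rw [hmean, hvar] at h
  simp only [Finset.sum_apply, aux_var] at h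
  refine (ENNReal.toReal_le_of_le_ofReal ?_ h).trans (le_of_eq ?_)
  · positivity
  · congr 1
    rw [Finset.sum_add_distrib, ← Finset.sum_mul, ← Finset.mul_sum]
    simp; ring


/-- Let `σ > 0`, `d > 0`.  For each `n` let `f⁽ⁿ⁾ ∈ ℝⁿ` be a codeword with
average power `P_n = (1/n)·Σᵢ (f⁽ⁿ⁾ᵢ)²`, and suppose `√n·P_n → ∞`.  Willie's
test with threshold `t_n = d/√n` rejects the null hypothesis when
`S_n = (1/n)·Σᵢ Yᵢ² ≥ σ² + t_n`.  Then:
(i) under the null hypothesis (`Yᵢ = Zᵢ` i.i.d. `N(0,σ²)`), the false-alarm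
probability satisfies `α_n ≤ 2σ⁴/d²` for every `n`; and
(ii) under transmission of `f⁽ⁿ⁾` (`Yᵢ = f⁽ⁿ⁾ᵢ + Zᵢ`), the missed-detection
probability `β_n = P(S_n < σ² + t_n)` tends to `0` as `n → ∞`. -/
theorem stmt_18 (σ d : ℝ) (hσ : 0 < σ) (hd : 0 < d)
    (f : (n : ℕ) → Fin n → ℝ) (P : ℕ → ℝ)
    (hP : ∀ n, P n = (1 / n) * ∑ i, (f n i) ^ 2)
    (hpow : Tendsto (fun n : ℕ => Real.sqrt n * P n) atTop atTop) :
    (∀ n : ℕ,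
        ((Measure.pi fun _ : Fin n => gaussianReal 0 (σ ^ 2).toNNReal)
            {z : Fin n → ℝ |
              σ ^ 2 + d / Real.sqrt n ≤ (1 / n : ℝ) * ∑ i, (z i) ^ 2}).toReal
          ≤ 2 * σ ^ 4 / d ^ 2) ∧
      Tendsto
        (fun n : ℕ =>
          ((Measure.pi fun _ : Fin n => gaussianReal 0 (σ ^ 2).toNNReal)
              {z : Fin n → ℝ |
                (1 / n : ℝ) * ∑ i, (f n i + z i) ^ 2 <
                  σ ^ 2 + d / Real.sqrt n}).toReal)
        atTop (nhds 0) := by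
  have hv : (((σ ^ 2).toNNReal : NNReal) : ℝ) = σ ^ 2 := Real.coe_toNNReal _ (sq_nonneg σ)
  constructor
  · intro n
    rcases Nat.eq_zero_or_pos n with rfl | hn
    · have : {z : Fin 0 → ℝ | σ ^ 2 + d / Real.sqrt (0 : ℕ) ≤
          (1 / (0 : ℕ) : ℝ) * ∑ i, (z i) ^ 2} = ∅ := by
        ext z
        simp [hσ.ne']
      rw [this]
      simp
      positivity
    have hn' : (0 : ℝ) < n := by exact_mod_cast hn
    have hs : 0 < Real.sqrt n := Real.sqrt_pos.2 hn'
    have hss : Real.sqrt n * Real.sqrt n = n := Real.mul_self_sqrt hn'.le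
    have h := aux_cheb (σ ^ 2).toNNReal n (fun _ => 0) (Real.sqrt n * d) (by positivity)
    rw [hv] at h
    refine (ENNReal.toReal_mono (measure_ne_top _ _) (measure_mono ?_)).trans (h.trans (le_of_eq ?_))
    · intro z hz
      simp only [Set.mem_ofPred_eq] at hz ⊢
      refine le_trans ?_ (le_abs_self _)
      have h2 := mul_le_mul_of_nonneg_left hz hn'.le
      have e1 : (n : ℝ) * (σ ^ 2 + d / Real.sqrt n) = n * σ ^ 2 + Real.sqrt n * d := by
        nth_rw 1 [mul_add]
        congr 1
        rw [← hss]; field_simp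
        simp
      have e2 : (n : ℝ) * (1 / n * ∑ i, (z i) ^ 2) = ∑ i, (z i) ^ 2 := by field_simp
      rw [e1, e2] at h2
      simp
      linarith
    · rw [mul_pow, Real.sq_sqrt hn'.le]
      simp
      field_simp
  · have hlim : Tendsto (fun n : ℕ => 16 * σ ^ 2 * (Real.sqrt n * P n)⁻¹
        + 8 * σ ^ 4 * ((Real.sqrt n * P n)⁻¹ * (Real.sqrt n * P n)⁻¹)) atTop (nhds 0) := by
      have hi := hpow.inv_tendsto_atTop
      have := (hi.const_mul (16 * σ ^ 2)).add ((hi.mul hi).const_mul (8 * σ ^ 4))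
      simpa using this
    refine squeeze_zero' (Eventually.of_forall fun n => ENNReal.toReal_nonneg) ?_ hlim
    filter_upwards [hpow.eventually_ge_atTop (2 * d), eventually_ge_atTop 1] with n hx hn
    have hn' : (1 : ℝ) ≤ n := by exact_mod_cast hn
    have hn0 : (0 : ℝ) < n := by linarith
    have hs1 : 1 ≤ Real.sqrt n := Real.one_le_sqrt.2 hn'
    have hs : 0 < Real.sqrt n := by linarith
    have hss : Real.sqrt n * Real.sqrt n = n := Real.mul_self_sqrt hn0.le
    have hsum : ∑ i, f n i ^ 2 = n * P n := by rw [hP]; field_simp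
    have hP0 : 0 ≤ P n := by rw [hP]; positivity
    set s := Real.sqrt n with hsdef
    set x := s * P n with hxdef
    have hx0 : 0 < x := by linarith
    have hPx : P n ≤ x := by nlinarith
    have h := aux_cheb (σ ^ 2).toNNReal n (f n) (s * (x - d)) (mul_pos hs (by linarith))
    rw [hv, hsum] at h
    refine (ENNReal.toReal_mono (measure_ne_top _ _) (measure_mono ?_)).trans (h.trans ?_)
    · intro z hz
      simp only [Set.mem_ofPred_eq] at hz ⊢
      refine le_trans ?_ (neg_le_abs _)
      have h2 := mul_le_mul_of_nonneg_left hz.le hn0.le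
      have e1 : (n : ℝ) * (σ ^ 2 + d / s) = n * σ ^ 2 + s * d := by
        have : (n : ℝ) * (d / s) = s * d := by rw [← hss]; field_simp
        rw [mul_add, this]
      have e2 : (n : ℝ) * (1 / n * ∑ i, (f n i + z i) ^ 2) = ∑ i, (f n i + z i) ^ 2 := by
        field_simp
      rw [e1, e2] at h2
      have e3 : s * (x - d) = n * P n - s * d := by rw [hxdef, ← hss]; ring
      rw [e3]
      linarith
    · have e : (4 * σ ^ 2 * (n * P n) + 2 * n * (σ ^ 2) ^ 2) / (s * (x - d)) ^ 2
          = (4 * σ ^ 2 * P n + 2 * σ ^ 4) / (x - d) ^ 2 := by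
        have : x - d ≠ 0 := by linarith
        rw [← hss]; field_simp
      rw [e]
      have e' : 16 * σ ^ 2 * x⁻¹ + 8 * σ ^ 4 * (x⁻¹ * x⁻¹)
          = (4 * σ ^ 2 * x + 2 * σ ^ 4) / (x / 2) ^ 2 := by
        field_simp; ring
      rw [e']
      gcongr
      linarith
end
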